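/- The map T ↦ F_T ∩ K is a bijection from the set of topes of L(A,K) to the set of connected components of K ∖ ∪_{e∈E} H_e. -/

import Mathlib

/-- Composition of sign vectors: `(X ∘ Y) e = X e` if `X e ≠ 0`, and `Y e` otherwise. -/
def scomp {E : Type*} (X Y : E → SignType) : E → SignType :=
  fun e => if X e = 0 then Y e else X e

/-- The partial order on sign vectors: `X ≤ Y` iff `X ∘ Y = Y`. -/
def sle {E : Type*} (X Y : E → SignType) : Prop := scomp X Y = Y

theorem sle_refl {E : Type*} (X : E → SignType) : sle X X := by
  funext e; show (if X e = 0 then X e else X e) = X e; split <;> rfl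

theorem sle_trans {E : Type*} {X Y Z : E → SignType} (h₁ : sle X Y) (h₂ : sle Y Z) :
    sle X Z := by
  funext e
  have h1 := congrFun h₁ e
  have h2 := congrFun h₂ e
  revert h1 h2
  show (if X e = 0 then Y e else X e) = Y e → (if Y e = 0 then Z e else Y e) = Z e →
    (if X e = 0 then Z e else X e) = Z e
  generalize X e = a; generalize Y e = b; generalize Z e = c
  revert a b c; decide

theorem sle_antisymm {E : Type*} {X Y : E → SignType} (h₁ : sle X Y) (h₂ : sle Y X) :
    X = Y := by
  funext e
  have h1 := congrFun h₁ e
  have h2 := congrFun h₂ e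
  revert h1 h2
  show (if X e = 0 then Y e else X e) = Y e → (if Y e = 0 then X e else Y e) = X e → X e = Y e
  generalize X e = a; generalize Y e = b
  revert a b; decide

/-- The separating set of two sign vectors: the indices where they take opposite
nonzero signs. -/
def SepSet {E : Type*} (X Y : E → SignType) : Set E :=
  {e | (X e = 1 ∧ Y e = -1) ∨ (X e = -1 ∧ Y e = 1)}

section Geometry

variable {E : Type*} {V : Type*} [NormedAddCommGroup V] [NormedSpace ℝ V]

/-- The face of a sign vector `X`, relative to the family of cooriented affine hyperplanes
`H_e = {v | f e v = 0}`, with positive side `H_e⁺ = {v | f e v > 0}` and negative side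
`H_e⁻ = {v | f e v < 0}`. -/
def face (f : E → (V →ᵃ[ℝ] ℝ)) (X : E → SignType) : Set V :=
  {v | ∀ e, SignType.sign (f e v) = X e}

/-- The conditional oriented matroid `L(A,K)`: the set of sign vectors whose face
meets `K`. -/
def covs (f : E → (V →ᵃ[ℝ] ℝ)) (K : Set V) : Set (E → SignType) :=
  {X | (face f X ∩ K).Nonempty}

/-- A tope of `L(A,K)`: a maximal covector. -/
def IsTope (f : E → (V →ᵃ[ℝ] ℝ)) (K : Set V) (T : E → SignType) : Prop :=
  T ∈ covs f K ∧ ∀ Y ∈ covs f K, sle T Y → Y = T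

/-- The set of topes of `L(A,K)`, as a type carrying the discrete topology. -/
def Topes (f : E → (V →ᵃ[ℝ] ℝ)) (K : Set V) : Type _ := {T : E → SignType // IsTope f K T}

instance (f : E → (V →ᵃ[ℝ] ℝ)) (K : Set V) : TopologicalSpace (Topes f K) := ⊥

instance (f : E → (V →ᵃ[ℝ] ℝ)) (K : Set V) : DiscreteTopology (Topes f K) := ⟨rfl⟩

/-- Points of `K × T(A,K)`. -/
abbrev ZPre (f : E → (V →ᵃ[ℝ] ℝ)) (K : Set V) : Type _ := K × Topes f K

/-- The gluing relation defining `Z(A,K)`: `(v,T) ∼ (v',T')` iff `v = v'` and `v` lies on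
no hyperplane separating `T` from `T'`. -/
def ZRel (f : E → (V →ᵃ[ℝ] ℝ)) (K : Set V) : ZPre f K → ZPre f K → Prop :=
  fun p q => (p.1 : V) = (q.1 : V) ∧ ∀ e ∈ SepSet p.2.1 q.2.1, f e (p.1 : V) ≠ 0

/-- The space `Z(A,K)`: one copy of `K` for each tope, glued along the complement of the
separating hyperplanes, with the quotient topology. -/
def ZSpace (f : E → (V →ᵃ[ℝ] ℝ)) (K : Set V) : Type _ := Quot (ZRel f K)

instance (f : E → (V →ᵃ[ℝ] ℝ)) (K : Set V) : TopologicalSpace (ZSpace f K) :=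
  inferInstanceAs (TopologicalSpace (Quot (ZRel f K)))

/-- The projection `π : Z(A,K) → V` (with image `K`), sending `[(v,T)]` to `v`. -/
def Zproj (f : E → (V →ᵃ[ℝ] ℝ)) (K : Set V) : ZSpace f K → V :=
  Quot.lift (fun p => (p.1 : V)) (fun _ _ h => h.1)

/-- The set `K_{X,T} = K ∩ ⋂_{e : X_e = 0} H_e^{T_e}`. -/
def KXT (f : E → (V →ᵃ[ℝ] ℝ)) (K : Set V) (X T : E → SignType) : Set V :=
  K ∩ ⋂ e ∈ {e | X e = 0}, {v | SignType.sign (f e v) = T e}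

/-- The subset `U_{X,T} ⊆ Z(A,K)`: the image of `K_{X,T} × {T}` under the quotient map. -/
def UXT (f : E → (V →ᵃ[ℝ] ℝ)) (K : Set V) (X : E → SignType) (T : Topes f K) :
    Set (ZSpace f K) :=
  {z | ∃ (v : V) (hv : v ∈ K), v ∈ KXT f K X T.1 ∧ z = Quot.mk (ZRel f K) (⟨v, hv⟩, T)}

/-- The complexified complement `M(A,K)`, where `V ⊗ ℂ` is modeled as `V × V` (real and
imaginary parts): `v + iw` lies on `H_e ⊗ ℂ` iff `f e v = 0` and the linear part of `f e`
vanishes on `w`. -/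
def MSpace (f : E → (V →ᵃ[ℝ] ℝ)) (K : Set V) : Type _ :=
  {p : V × V // p.1 ∈ K ∧ ∀ e, ¬(f e p.1 = 0 ∧ (f e).linear p.2 = 0)}

instance (f : E → (V →ᵃ[ℝ] ℝ)) (K : Set V) : TopologicalSpace (MSpace f K) :=
  inferInstanceAs (TopologicalSpace {p : V × V // p.1 ∈ K ∧ _})

/-- The projection `ρ : M(A,K) → V` (with image `K`), sending `v + iw` to `v`. -/
def Mproj (f : E → (V →ᵃ[ℝ] ℝ)) (K : Set V) : MSpace f K → V := fun p => p.1.1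

end Geometry

variable {V : Type*} [NormedAddCommGroup V] [NormedSpace ℝ V] [FiniteDimensional ℝ V]
variable {E : Type*} [Fintype E]

/-- Faces are convex. -/
theorem convex_face {E V : Type*} [NormedAddCommGroup V] [NormedSpace ℝ V]
    (f : E → (V →ᵃ[ℝ] ℝ)) (X : E → SignType) : Convex ℝ (face f X) := by
  have hface : face f X = ⋂ e, f e ⁻¹' (SignType.sign ⁻¹' {X e}) := by
    ext v
    simp [face]
  rw [hface]
  refine convex_iInter fun e => Convex.affine_preimage (f e) ?_
  exact (Set.ordConnected_singleton.preimage_mono SignType.sign.monotone).convex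

/-- A covector without zero entries is a tope. -/
theorem isTope_of_forall_ne_zero {E V : Type*} [NormedAddCommGroup V] [NormedSpace ℝ V]
    {f : E → (V →ᵃ[ℝ] ℝ)} {K : Set V} {T : E → SignType} (hT : T ∈ covs f K)
    (h : ∀ e, T e ≠ 0) : IsTope f K T := by
  refine ⟨hT, fun Y _ hY => ?_⟩
  funext e
  have he := congrFun hY e
  simpa [scomp, h e] using he.symm

/-- Topes have no zero entries: a point of `K` on a hyperplane can be moved off it without
changing the nonzero signs. -/
theorem IsTope.ne_zero {E V : Type*} [Finite E] [NormedAddCommGroup V] [NormedSpace ℝ V]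
    [FiniteDimensional ℝ V] {f : E → (V →ᵃ[ℝ] ℝ)} (hf : ∀ e, (f e).linear ≠ 0)
    {K : Set V} (hK : IsOpen K) {T : E → SignType} (hT : IsTope f K T) (e : E) : T e ≠ 0 := by
  intro he
  obtain ⟨⟨v, hvT, hvK⟩, hmax⟩ := hT
  obtain ⟨w, hw⟩ : ∃ w, (f e).linear w ≠ 0 := by
    by_contra! h
    exact hf e (LinearMap.ext h)
  have hcont : Continuous fun t : ℝ => t • w + v := by fun_prop
  have hlim : Filter.Tendsto (fun t : ℝ => t • w + v) (nhds 0) (nhds v) := by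
    simpa using hcont.tendsto 0
  have hmemK : ∀ᶠ t : ℝ in nhds 0, t • w + v ∈ K := hlim (hK.mem_nhds hvK)
  have hsign : ∀ᶠ t : ℝ in nhds 0, ∀ e', T e' ≠ 0 →
      SignType.sign (f e' (t • w + v)) = T e' := by
    rw [Filter.eventually_all]
    intro e'
    by_cases h0 : T e' = 0
    · simp [h0]
    · have hne : f e' v ≠ 0 := by
        rw [← sign_ne_zero, hvT e']
        exact h0
      have hc : ContinuousAt (fun x => SignType.sign (f e' x)) v :=
        (continuousAt_sign_of_ne_zero hne).comp
          (f e').continuous_of_finiteDimensional.continuousAt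
      have hev := (hc.tendsto.comp hlim).eventually_mem
        ((isOpen_discrete {T e'}).mem_nhds (hvT e'))
      filter_upwards [hev] with t ht _
      exact ht
  obtain ⟨t, ⟨htK, hts⟩, ht0⟩ :=
    (((hmemK.and hsign).filter_mono nhdsWithin_le_nhds).and
      (self_mem_nhdsWithin : {0}ᶜ ∈ nhdsWithin (0 : ℝ) {0}ᶜ)).exists
  have hY : (fun e' => SignType.sign (f e' (t • w + v))) = T := by
    refine hmax _ ⟨t • w + v, fun _ => rfl, htK⟩ ?_
    funext e'
    by_cases h0 : T e' = 0
    · simp [scomp, h0]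
    · simp [scomp, h0, hts e' h0]
  have hv0 : f e v = 0 := by
    rw [← sign_eq_zero_iff, hvT e, he]
  have hval : f e (t • w + v) = t * (f e).linear w := by
    have := (f e).map_vadd v (t • w)
    simpa [hv0] using this
  have := congrFun hY e
  rw [he] at this
  have hzero : f e (t • w + v) = 0 := sign_eq_zero_iff.mp this
  rw [hval] at hzero
  exact (mul_ne_zero ht0 hw) hzero

/-- The component of a point `v` of `K` off the hyperplanes is the part in `K` of the face
through `v`. -/
theorem face_inter_eq_connectedComponentIn {E V : Type*} [NormedAddCommGroup V]
    [NormedSpace ℝ V] [FiniteDimensional ℝ V] {f : E → (V →ᵃ[ℝ] ℝ)} {K : Set V}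
    (hK : Convex ℝ K) {T : E → SignType} (hT : ∀ e, T e ≠ 0) {v : V}
    (hv : v ∈ face f T ∩ K) :
    face f T ∩ K = connectedComponentIn (K \ ⋃ e, {w | f e w = 0}) v := by
  have hsub : face f T ∩ K ⊆ K \ ⋃ e, {w | f e w = 0} := by
    rintro x ⟨hxT, hxK⟩
    refine ⟨hxK, ?_⟩
    simp only [Set.mem_iUnion, Set.mem_ofPred_eq, not_exists]
    intro e h
    apply hT e
    rw [← hxT e, h, sign_zero]
  apply Set.Subset.antisymm
  · exact ((convex_face f T).inter hK).isPreconnected.subset_connectedComponentIn hv hsub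
  · intro x hx
    have hcomp := connectedComponentIn_subset (K \ ⋃ e, {w | f e w = 0}) v
    refine ⟨fun e => ?_, (hcomp hx).1⟩
    rw [← hv.1 e]
    have hcont : ContinuousOn (fun y => SignType.sign (f e y))
        (connectedComponentIn (K \ ⋃ e, {w | f e w = 0}) v) := by
      intro y hy
      have hne : f e y ≠ 0 := fun h => (hcomp hy).2 (Set.mem_iUnion.mpr ⟨e, h⟩)
      exact ((continuousAt_sign_of_ne_zero hne).comp
        (f e).continuous_of_finiteDimensional.continuousAt).continuousWithinAt
    exact isPreconnected_connectedComponentIn.constant hcont hx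
      (mem_connectedComponentIn (hsub hv))

/-- The map `T ↦ F_T ∩ K` is a bijection from the set of topes of `L(A,K)` onto the set
of connected components of `K ∖ ⋃_e H_e`. -/
theorem topes_biject_components
    (f : E → (V →ᵃ[ℝ] ℝ)) (hf : ∀ e, (f e).linear ≠ 0)
    (K : Set V) (hKne : K.Nonempty) (hKconv : Convex ℝ K) (hKopen : IsOpen K) :
    Function.Injective (fun T : Topes f K => face f T.1 ∩ K) ∧
      Set.range (fun T : Topes f K => face f T.1 ∩ K) =
        {Comp : Set V | ∃ v ∈ K \ ⋃ e, {w | f e w = 0},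
          Comp = connectedComponentIn (K \ ⋃ e, {w | f e w = 0}) v} := by
  constructor
  · intro T S h
    obtain ⟨v, hv⟩ := T.2.1
    have hvS : v ∈ face f S.1 ∩ K := (Set.ext_iff.mp h v).mp hv
    exact Subtype.ext (funext fun e => (hv.1 e).symm.trans (hvS.1 e))
  · ext C
    constructor
    · rintro ⟨T, rfl⟩
      obtain ⟨v, hv⟩ := T.2.1
      have hT := T.2.ne_zero hf hKopen
      have heq := face_inter_eq_connectedComponentIn hKconv hT hv
      refine ⟨v, ?_, heq⟩
      rw [heq] at hv
      exact connectedComponentIn_subset _ _ hv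
    · rintro ⟨v, hv, rfl⟩
      have hT : ∀ e, SignType.sign (f e v) ≠ 0 := fun e h =>
        hv.2 (Set.mem_iUnion.mpr ⟨e, sign_eq_zero_iff.mp h⟩)
      have hvface : v ∈ face f (fun e => SignType.sign (f e v)) ∩ K := ⟨fun _ => rfl, hv.1⟩
      exact ⟨⟨_, isTope_of_forall_ne_zero ⟨v, hvface⟩ hT⟩,
        face_inter_eq_connectedComponentIn hKconv hT hvface⟩
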